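/- arXiv:2301.02843 — 2 statements merged into one kernel-verified Lean document; each statement's English description precedes it below -/
import Mathlib

section
/- Let t ≥ 1, m = 2t, n = 4t, and let e ≥ 0, s, u be integers with 0 < s < 2^t − 1, u = s(2^t − 1) + 2^{e+1}, gcd(2^e − s, 2^t + 1) = 1, gcd(u, 2^m − 1) = 1, and gcd(u − 2^e, 2^m − 1) = 1. Define F : F_{2^n} → F_{2^n} by F(x) = x^{2^e}·(Tr_{2^n/2^m}(x))^{u−2^e}. Then N_F ≤ 2^{n−1} − 2^{3n/4}; equivalently, max over a ∈ F_{2^n}, a ≠ 0, and ω ∈ F_{2^n} of |W_{F_a}(ω)| is at least 2^{3t+1}. -/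
open scoped Classical BigOperators

noncomputable section

/-- The finite field with `2^k` elements. -/
abbrev GF (k : ℕ) := GaloisField 2 k

noncomputable instance (k : ℕ) : Fintype (GF k) := Fintype.ofFinite _

/-- The absolute trace `Tr_{2^k/2}`, viewed as an element of `GF k`
(its values lie in the prime field `{0,1}`). -/
def atr (k : ℕ) (x : GF k) : GF k := ∑ j ∈ Finset.range k, x ^ 2 ^ j

/-- `(-1)^b` for `b ∈ {0,1} ⊆ GF k`. -/
def chi (k : ℕ) (x : GF k) : ℤ := if x = 0 then 1 else -1

/-- The Walsh transform of a Boolean-valued function `f` on `GF k`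
(`f` takes values in the prime field `{0,1}`). -/
def walsh (k : ℕ) (f : GF k → GF k) (ω : GF k) : ℤ :=
  ∑ x : GF k, chi k (f x + atr k (ω * x))

/-- The trace `Tr_{2^m/2}` of the subfield `K_m ⊆ GF (2*m)`, viewed inside `GF (2*m)`. -/
def trKm (m : ℕ) (x : GF (2*m)) : GF (2*m) := ∑ j ∈ Finset.range m, x ^ 2 ^ j

/-- The subfield `K_m = {x : x^(2^m) = x}` of `GF (2*m)`, as a finset. -/
def Km (m : ℕ) : Finset (GF (2*m)) := Finset.univ.filter (fun x => x ^ 2 ^ m = x)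

/-- `max_{a ≠ 0, ω} |W_{F_a}(ω)|` for a vectorial function `F` on `GF (2*m)`. -/
def maxAbsW (m : ℕ) (F : GF (2*m) → GF (2*m)) : ℕ :=
  Finset.sup ((Finset.univ.filter (fun a : GF (2*m) => a ≠ 0)) ×ˢ (Finset.univ : Finset (GF (2*m))))
    (fun p => (walsh (2*m) (fun x => atr (2*m) (p.1 * F x)) p.2).natAbs)

/-- The nonlinearity `N_F = 2^(n-1) - (1/2) max_{a ≠ 0, ω} |W_{F_a}(ω)|`, `n = 2m`. -/
def nlin (m : ℕ) (F : GF (2*m) → GF (2*m)) : ℚ :=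
  2 ^ (2*m - 1) - (maxAbsW m F : ℚ) / 2


/-- The elements of a field of characteristic two fixed by `x ↦ x ^ 2 ^ t`. -/
def fixedSubfield (F : Type*) [Field F] [CharP F 2] (t : ℕ) : Subfield F :=
  (iterateFrobenius F 2 t).eqLocusField (RingHom.id F)

section FixedSubfield

variable {F : Type*} [Field F] [CharP F 2]

lemma mem_fixedSubfield {t : ℕ} {x : F} : x ∈ fixedSubfield F t ↔ x ^ 2 ^ t = x := by
  simp [fixedSubfield, RingHom.mem_eqLocusField, iterateFrobenius_def]

instance (t : ℕ) : CharP (fixedSubfield F t) 2 :=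
  (algebraMap (fixedSubfield F t) F).charP (algebraMap (fixedSubfield F t) F).injective 2

lemma card_fixedSubfield_le {t : ℕ} (ht : t ≠ 0) :
    Nat.card (fixedSubfield F t) ≤ 2 ^ t := by
  have hne : (Polynomial.X ^ 2 ^ t - Polynomial.X : Polynomial F) ≠ 0 :=
    FiniteField.X_pow_card_pow_sub_X_ne_zero F ht one_lt_two
  have hsub : (fixedSubfield F t : Set F) ⊆
      ((Polynomial.X ^ 2 ^ t - Polynomial.X : Polynomial F).roots.toFinset : Set F) := by
    intro x hx
    have hx' : x ^ 2 ^ t = x := mem_fixedSubfield.1 hx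
    simp [hne, Polynomial.IsRoot, hx']
  have hle := Set.ncard_le_ncard hsub (Finset.finite_toSet _)
  rw [Set.ncard_coe_finset] at hle
  calc Nat.card (fixedSubfield F t) = (fixedSubfield F t : Set F).ncard := rfl
    _ ≤ _ := hle
    _ ≤ _ := Multiset.toFinset_card_le _
    _ ≤ _ := Polynomial.card_roots' _
    _ = 2 ^ t := FiniteField.X_pow_card_pow_sub_X_natDegree_eq F ht one_lt_two

variable [Fintype F]

/-- The relative trace `x ↦ x + x ^ 2 ^ t` of a quadratic extension onto its subfield. -/
def relTrace {t : ℕ} (hF : Fintype.card F = (2 ^ t) ^ 2) : F →+ fixedSubfield F t where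
  toFun x := ⟨x + x ^ 2 ^ t, by
    have h : (x ^ 2 ^ t) ^ 2 ^ t = x := by
      rw [← pow_mul, ← pow_two, ← hF, FiniteField.pow_card]
    rw [mem_fixedSubfield, add_pow_char_pow, h, add_comm]⟩
  map_zero' := by ext; simp
  map_add' x y := by
    ext
    simp only [add_pow_char_pow, Subfield.coe_add]
    ring

lemma coe_relTrace {t : ℕ} (hF : Fintype.card F = (2 ^ t) ^ 2) (x : F) :
    (relTrace hF x : F) = x + x ^ 2 ^ t := rfl

lemma card_relTrace_ker {t : ℕ} (hF : Fintype.card F = (2 ^ t) ^ 2) :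
    Nat.card (relTrace hF).ker = Nat.card (fixedSubfield F t) := by
  refine Nat.card_congr (Equiv.subtypeEquivRight fun x => ?_)
  rw [AddMonoidHom.mem_ker, mem_fixedSubfield, Subtype.ext_iff, coe_relTrace]
  rw [ZeroMemClass.coe_zero, CharTwo.add_eq_zero, eq_comm]

lemma card_fixedSubfield_and_relTrace_surjective {t : ℕ} (ht : t ≠ 0)
    (hF : Fintype.card F = (2 ^ t) ^ 2) :
    Nat.card (fixedSubfield F t) = 2 ^ t ∧ Function.Surjective (relTrace hF) := by
  have hmul := (relTrace hF).ker.card_mul_index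
  rw [AddSubgroup.index_ker, card_relTrace_ker, Nat.card_eq_fintype_card (α := F), hF] at hmul
  have hle := card_fixedSubfield_le (F := F) ht
  have hr : Nat.card (relTrace hF).range ≤ Nat.card (fixedSubfield F t) :=
    Nat.card_le_card_of_injective _ Subtype.val_injective
  have hq : 0 < 2 ^ t := by positivity
  have hk : Nat.card (fixedSubfield F t) = 2 ^ t := by nlinarith
  refine ⟨hk, ?_⟩
  rw [hk, pow_two] at hmul
  rw [← AddMonoidHom.range_eq_top]
  apply AddSubgroup.eq_top_of_card_eq
  rw [hk]
  exact Nat.eq_of_mul_eq_mul_left hq hmul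

end FixedSubfield

/-- A sum over a finite group of a function factoring through a surjective homomorphism. -/
lemma AddMonoidHom.card_mul_sum_comp {G H : Type*} [AddGroup G] [AddGroup H] [Fintype G]
    [Fintype H] (f : G →+ H) (hf : Function.Surjective f) (g : H → ℤ) :
    (Fintype.card H : ℤ) * ∑ x, g (f x) = Fintype.card G * ∑ y, g y := by
  have hfib : ∀ h : H → ℤ, ∑ x, h (f x) =
      (Finset.univ.filter fun x => f x = 0).card * ∑ y, h y := by
    intro h
    rw [← Finset.sum_fiberwise (s := Finset.univ) (g := f), Finset.mul_sum]
    refine Finset.sum_congr rfl fun y _ => ?_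
    rw [Finset.sum_congr rfl (g := fun _ => h y)
      (fun x hx => by rw [(Finset.mem_filter.1 hx).2]), Finset.sum_const, nsmul_eq_mul,
      AddMonoidHom.card_fiber_eq_of_mem_range f (hf y) (hf 0)]
  have hone := hfib fun _ => 1
  simp only [Finset.sum_const, Finset.card_univ, nsmul_eq_mul, mul_one] at hone
  rw [hfib g, hone]
  ring

lemma sum_sq_pow_two_pow {F : Type*} [Field F] [Fintype F] {k : ℕ}
    (hF : Fintype.card F = 2 ^ k) (x : F) :
    ∑ j ∈ Finset.range k, (x ^ 2) ^ 2 ^ j = ∑ j ∈ Finset.range k, x ^ 2 ^ j := by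
  have h := (Finset.sum_range_succ (fun j => x ^ 2 ^ j) k).symm.trans
    (Finset.sum_range_succ' (fun j => x ^ 2 ^ j) k)
  rw [← hF, FiniteField.pow_card, pow_zero, pow_one] at h
  rw [add_right_cancel h]
  simp only [← pow_mul, pow_succ' 2]

section TraceSign

variable {F : Type*} [Field F] [CharP F 2]

lemma sum_pow_two_pow_add (k : ℕ) (x y : F) :
    ∑ j ∈ Finset.range k, (x + y) ^ 2 ^ j =
      ∑ j ∈ Finset.range k, x ^ 2 ^ j + ∑ j ∈ Finset.range k, y ^ 2 ^ j := by
  simp only [add_pow_char_pow, Finset.sum_add_distrib]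

variable [Fintype F]

lemma sum_pow_two_pow_eq_zero_or_one {k : ℕ} (hF : Fintype.card F = 2 ^ k) (x : F) :
    ∑ j ∈ Finset.range k, x ^ 2 ^ j = 0 ∨ ∑ j ∈ Finset.range k, x ^ 2 ^ j = 1 := by
  have h : (∑ j ∈ Finset.range k, x ^ 2 ^ j) ^ 2 = ∑ j ∈ Finset.range k, x ^ 2 ^ j := by
    rw [sum_pow_char]
    simp only [pow_right_comm x _ 2]
    exact sum_sq_pow_two_pow hF x
  rw [pow_two] at h
  exact IsIdempotentElem.iff_eq_zero_or_one.1 h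

/-- The additive character `x ↦ (-1) ^ Tr x` of a field with `2 ^ k` elements. -/
def traceSign {k : ℕ} (hF : Fintype.card F = 2 ^ k) : AddChar F ℤ where
  toFun x := if ∑ j ∈ Finset.range k, x ^ 2 ^ j = 0 then 1 else -1
  map_zero_eq_one' := by simp
  map_add_eq_mul' x y := by
    rw [sum_pow_two_pow_add]
    rcases sum_pow_two_pow_eq_zero_or_one hF x with hx | hx <;>
    rcases sum_pow_two_pow_eq_zero_or_one hF y with hy | hy <;>
    simp [hx, hy, CharTwo.add_self_eq_zero]

lemma traceSign_apply {k : ℕ} (hF : Fintype.card F = 2 ^ k) (x : F) :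
    traceSign hF x = if ∑ j ∈ Finset.range k, x ^ 2 ^ j = 0 then 1 else -1 := rfl

lemma traceSign_sq {k : ℕ} (hF : Fintype.card F = 2 ^ k) (x : F) :
    traceSign hF (x ^ 2) = traceSign hF x := by
  rw [traceSign_apply, traceSign_apply, sum_sq_pow_two_pow hF]

lemma traceSign_relTrace {t : ℕ} (hF : Fintype.card F = (2 ^ t) ^ 2)
    (hF' : Fintype.card F = 2 ^ (2 * t)) (hk : Fintype.card (fixedSubfield F t) = 2 ^ t) (x : F) :
    traceSign hk (relTrace hF x) = traceSign hF' x := by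
  have h : ((∑ j ∈ Finset.range t, relTrace hF x ^ 2 ^ j : fixedSubfield F t) : F) =
      ∑ j ∈ Finset.range (2 * t), x ^ 2 ^ j := by
    push_cast
    simp only [coe_relTrace, add_pow_char_pow, Finset.sum_add_distrib]
    rw [two_mul, Finset.sum_range_add]
    simp only [← pow_mul, ← pow_add]
  rw [traceSign_apply, traceSign_apply, ← h]
  simp only [ZeroMemClass.coe_eq_zero]
  congr

end TraceSign

lemma AddChar.apply_pow_two_pow {K : Type*} [Field K] (φ : AddChar K ℤ)
    (hφ : ∀ x, φ (x ^ 2) = φ x) (j : ℕ) (x : K) :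
    φ (x ^ 2 ^ j) = φ x := by
  induction j with
  | zero => simp
  | succ j ih => rw [pow_succ, pow_mul, hφ, ih]

lemma pow_niho {k : Type*} [Field k] [Fintype k] {q : ℕ} (hk : Fintype.card k = q) {d : ℕ}
    (hd : d ≠ 0) (s : ℕ) (r : k) : r ^ (s * (q - 1) + d) = r ^ d := by
  rcases eq_or_ne r 0 with rfl | hr
  · rw [zero_pow hd, zero_pow (by omega)]
  · rw [pow_add, mul_comm s, pow_mul, ← hk, FiniteField.pow_card_sub_one_eq_one r hr, one_pow,
      one_mul]

lemma pow_bijective_of_coprime {K : Type*} [Field K] [Fintype K] {u : ℕ}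
    (hu0 : u ≠ 0) (hu : u.Coprime (Fintype.card K - 1)) :
    Function.Bijective fun c : K => c ^ u := by
  refine Finite.injective_iff_bijective.1 fun a b (hab : a ^ u = b ^ u) => ?_
  rcases eq_or_ne b 0 with rfl | hb
  · exact eq_zero_of_pow_eq_zero (hab.trans (zero_pow hu0))
  · have ha : a ≠ 0 := by
      rintro rfl
      exact hb (eq_zero_of_pow_eq_zero (hab.symm.trans (zero_pow hu0)))
    have hone : (a / b) ^ u = 1 := by rw [div_pow, hab, div_self (pow_ne_zero _ hb)]
    have hcard := FiniteField.pow_card_sub_one_eq_one (a / b) (div_ne_zero ha hb)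
    have h1 := orderOf_dvd_of_pow_eq_one hone
    have h2 := orderOf_dvd_of_pow_eq_one hcard
    have h3 := Nat.eq_one_of_dvd_coprimes hu h1 h2
    exact (div_eq_one_iff_eq hb).1 (orderOf_eq_one_iff.1 h3)

section NihoPower

variable {K : Type*} [Field K] [CharP K 2] [Fintype K]

lemma dvd_sum_subfield_line (φ : AddChar K ℤ) (hφ : ∀ x, φ (x ^ 2) = φ x) (k : Subfield K)
    [CharP k 2] {q : ℕ} (hk : Fintype.card k = q) (s e : ℕ) (ω c : K) :
    (q : ℤ) ∣ ∑ r : k, φ ((r * c) ^ (s * (q - 1) + 2 ^ (e + 1)) + ω * (r * c)) := by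
  set u := s * (q - 1) + 2 ^ (e + 1)
  let χ : AddChar k ℤ :=
    { toFun := fun r => φ (r * (c ^ u + (ω * c) ^ 2 ^ (e + 1)))
      map_zero_eq_one' := by simp
      map_add_eq_mul' := fun a b => by
        rw [Subfield.coe_add, add_mul, AddChar.map_add_eq_mul] }
  have hterm : ∀ r : k, φ ((r * c) ^ u + ω * (r * c)) = χ (r ^ 2 ^ (e + 1)) := by
    intro r
    have hr : (r : K) ^ u = (r : K) ^ 2 ^ (e + 1) := by
      exact_mod_cast congrArg (Subtype.val) (pow_niho hk (by positivity) s r)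
    change _ = φ (((r ^ 2 ^ (e + 1) : k) : K) * (c ^ u + (ω * c) ^ 2 ^ (e + 1)))
    rw [AddChar.map_add_eq_mul, ← φ.apply_pow_two_pow hφ (e + 1) (ω * (r * c)),
      ← AddChar.map_add_eq_mul, mul_pow, hr]
    congr 1
    push_cast
    ring
  have hbij : Function.Bijective fun r : k => r ^ 2 ^ (e + 1) :=
    Finite.injective_iff_bijective.1 (iterateFrobenius_inj k 2 (e + 1))
  simp only [hterm]
  rw [hbij.sum_comp (fun r => χ r), AddChar.sum_eq_ite, hk]
  split_ifs <;> simp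

lemma dvd_sum_niho {t : ℕ} (ht : t ≠ 0) (hK : Fintype.card K = (2 ^ t) ^ 2) (φ : AddChar K ℤ)
    (hφ : ∀ x, φ (x ^ 2) = φ x) (s e : ℕ) (ω : K) :
    (2 ^ t : ℤ) ∣ ∑ c, φ (c ^ (s * (2 ^ t - 1) + 2 ^ (e + 1)) + ω * c) := by
  have hk : Fintype.card (fixedSubfield K t) = 2 ^ t := by
    rw [← Nat.card_eq_fintype_card]
    exact (card_fixedSubfield_and_relTrace_surjective ht hK).1
  set u := s * (2 ^ t - 1) + 2 ^ (e + 1) with hu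
  have hu0 : u ≠ 0 := by positivity
  have hdvd : (2 ^ t : ℤ) ∣
      ∑ c : K, ∑ r : fixedSubfield K t, φ ((r * c) ^ u + ω * (r * c)) :=
    Finset.dvd_sum fun c _ => by
      exact_mod_cast dvd_sum_subfield_line φ hφ (fixedSubfield K t) hk s e ω c
  rw [Finset.sum_comm, ← Finset.add_sum_erase _ _ (Finset.mem_univ 0)] at hdvd
  have hscale : ∀ r ∈ Finset.univ.erase (0 : fixedSubfield K t),
      ∑ c : K, φ ((r * c) ^ u + ω * (r * c)) = ∑ c, φ (c ^ u + ω * c) := by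
    intro r hr
    have hr0 : (r : K) ≠ 0 := by simpa using (Finset.mem_erase.1 hr).1
    exact Equiv.sum_comp (Equiv.mulLeft₀ (r : K) hr0) fun c => φ (c ^ u + ω * c)
  rw [Finset.sum_congr rfl hscale, Finset.sum_const, Finset.card_erase_of_mem (Finset.mem_univ _),
    Finset.card_univ, hk] at hdvd
  simp only [ZeroMemClass.coe_zero, zero_mul, zero_pow hu0, mul_zero, add_zero,
    AddChar.map_zero_eq_one, Finset.sum_const, Finset.card_univ, hK, nsmul_eq_mul, mul_one] at hdvd
  rw [Nat.cast_sub Nat.one_le_two_pow] at hdvd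
  push_cast at hdvd
  have hsq : (2 ^ t : ℤ) ∣ (2 ^ t) ^ 2 := dvd_pow_self _ two_ne_zero
  have hprod := (dvd_add_right hsq).1 hdvd
  rw [sub_one_mul] at hprod
  exact (dvd_sub_right (dvd_mul_right _ _)).1 hprod

lemma sum_walsh_sq (φ : AddChar K ℤ) (hφ1 : φ ≠ 1) (hφsq : ∀ x, φ x * φ x = 1) (f : K → K) :
    ∑ ω, (∑ c, φ (f c + ω * c)) ^ 2 = (Fintype.card K : ℤ) ^ 2 := by
  have hprim := AddChar.IsPrimitive.of_ne_one hφ1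
  have hexpand : ∀ ω, (∑ c, φ (f c + ω * c)) ^ 2 =
      ∑ c, ∑ d, φ (f c + f d) * φ (ω * (c + d)) := by
    intro ω
    rw [pow_two, Finset.sum_mul_sum]
    refine Finset.sum_congr rfl fun c _ => Finset.sum_congr rfl fun d _ => ?_
    simp only [← AddChar.map_add_eq_mul]
    congr 1
    ring
  simp only [hexpand]
  rw [Finset.sum_comm]
  have hinner : ∀ c, ∑ ω, ∑ d, φ (f c + f d) * φ (ω * (c + d)) = Fintype.card K := by
    intro c
    rw [Finset.sum_comm]
    simp only [← Finset.mul_sum, AddChar.sum_mulShift _ hprim, CharTwo.add_eq_zero]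
    simp [AddChar.map_add_eq_mul, hφsq]
  simp only [hinner, Finset.sum_const, Finset.card_univ, nsmul_eq_mul]
  ring

/-- A Niho power permutation has a Walsh coefficient of absolute value at least `2 ^ (t + 1)`. -/
lemma exists_large_walsh_niho {t : ℕ} (ht : t ≠ 0) (hK : Fintype.card K = (2 ^ t) ^ 2)
    (φ : AddChar K ℤ) (hφ1 : φ ≠ 1) (hφ : ∀ x, φ (x ^ 2) = φ x) (hφsq : ∀ x, φ x * φ x = 1)
    (s e : ℕ) (hu : (s * (2 ^ t - 1) + 2 ^ (e + 1)).Coprime (Fintype.card K - 1)) :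
    ∃ ω : K, 2 * 2 ^ t ≤ |∑ c, φ (c ^ (s * (2 ^ t - 1) + 2 ^ (e + 1)) + ω * c)| := by
  set u := s * (2 ^ t - 1) + 2 ^ (e + 1) with hu_def
  have hzero : ∑ c, φ (c ^ u + 0 * c) = 0 := by
    simp only [zero_mul, add_zero]
    rw [(pow_bijective_of_coprime (by positivity) hu).sum_comp fun c => φ c]
    exact AddChar.sum_eq_zero_of_ne_one hφ1
  by_contra! hsmall
  have hle : ∀ ω, (∑ c, φ (c ^ u + ω * c)) ^ 2 ≤ (2 ^ t : ℤ) ^ 2 := by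
    intro ω
    obtain ⟨a, ha⟩ := dvd_sum_niho ht hK φ hφ s e ω
    have hω := hsmall ω
    rw [← hu_def] at ha
    rw [ha, abs_mul, abs_of_pos (by positivity : (0 : ℤ) < 2 ^ t), mul_comm 2] at hω
    have ha2 : |a| ≤ 1 := by
      have := lt_of_mul_lt_mul_left hω (by positivity)
      omega
    rw [ha, mul_pow]
    have : a ^ 2 ≤ 1 := (sq_le_one_iff_abs_le_one a).2 ha2
    nlinarith [sq_nonneg ((2 : ℤ) ^ t)]
  have hlt : ∑ ω, (∑ c, φ (c ^ u + ω * c)) ^ 2 < ∑ _ω : K, (2 ^ t : ℤ) ^ 2 := by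
    refine Finset.sum_lt_sum (fun ω _ => hle ω) ⟨0, Finset.mem_univ _, ?_⟩
    rw [hzero]
    positivity
  rw [sum_walsh_sq φ hφ1 hφsq fun c => c ^ u, Finset.sum_const, Finset.card_univ, hK,
    nsmul_eq_mul] at hlt
  push_cast at hlt
  exact absurd hlt (by rw [← pow_two]; exact lt_irrefl _)

end NihoPower

lemma exists_atr_ne_zero {k : ℕ} (hk : k ≠ 0) : ∃ x, atr k x ≠ 0 := by
  obtain ⟨x, hx⟩ := Algebra.trace_surjective (ZMod 2) (GF k) 1
  refine ⟨x, ?_⟩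
  have h := FiniteField.algebraMap_trace_eq_sum_pow (ZMod 2) (GF k) x
  rw [hx, GaloisField.finrank 2 hk, Nat.card_zmod, map_one] at h
  rw [atr, ← h]
  exact one_ne_zero

lemma chi_atr_add {k : ℕ} (hk : Fintype.card (GF k) = 2 ^ k) (x y : GF k) :
    chi k (atr k x + atr k y) = traceSign hk (x + y) := by
  rw [traceSign_apply, sum_pow_two_pow_add]
  rfl

/-- Niho exponents case: with `n = 4t`, `m = 2t`,
`u = s(2^t−1)+2^(e+1)`, `gcd(2^e−s, 2^t+1)=1`, `0<s<2^t−1`,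
`gcd(u,2^m−1)=gcd(u−2^e,2^m−1)=1`, the function
`F(x) = x^(2^e)·(Tr_{2^n/2^m}(x))^(u−2^e)` satisfies `N_F ≤ 2^(n−1) − 2^(3n/4)`. -/
theorem stmt2 (t : ℕ) (ht : 1 ≤ t) (e s u : ℕ)
    (hs0 : 0 < s) (hs1 : s < 2 ^ t - 1)
    (huv : u = s * (2 ^ t - 1) + 2 ^ (e + 1))
    (hg1 : Int.gcd ((2 : ℤ) ^ e - (s : ℤ)) ((2 : ℤ) ^ t + 1) = 1)
    (hg2 : Nat.gcd u (2 ^ (2*t) - 1) = 1)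
    (hg3 : Nat.gcd (u - 2 ^ e) (2 ^ (2*t) - 1) = 1) :
    nlin (2*t) (fun x : GF (2*(2*t)) => x ^ 2 ^ e * (x + x ^ 2 ^ (2*t)) ^ (u - 2 ^ e))
      ≤ 2 ^ (4*t - 1) - 2 ^ (3*t) := by
  have hL : Fintype.card (GF (2 * (2 * t))) = 2 ^ (2 * (2 * t)) := by
    rw [← Nat.card_eq_fintype_card]
    exact GaloisField.card 2 _ (by omega)
  have hL2 : Fintype.card (GF (2 * (2 * t))) = (2 ^ (2 * t)) ^ 2 := by rw [hL]; ring
  obtain ⟨hKcard, hsurj⟩ :=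
    card_fixedSubfield_and_relTrace_surjective (by omega : 2 * t ≠ 0) hL2
  rw [Nat.card_eq_fintype_card] at hKcard
  have hK2 : Fintype.card (fixedSubfield (GF (2 * (2 * t))) (2 * t)) = (2 ^ t) ^ 2 := by
    rw [hKcard]; ring
  have hφψ := traceSign_relTrace hL2 hL hKcard
  set φ := traceSign hKcard with hφ_def
  have hφ1 : φ ≠ 1 := by
    intro h
    obtain ⟨x, hx⟩ := exists_atr_ne_zero (by omega : 2 * (2 * t) ≠ 0)
    have hx1 := hφψ x
    rw [h, AddChar.one_apply, traceSign_apply, ← atr, if_neg hx] at hx1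
    norm_num at hx1
  have hφsq : ∀ x, φ x * φ x = 1 := fun x => by
    rw [hφ_def, traceSign_apply]
    split_ifs <;> norm_num
  obtain ⟨ω, hω⟩ := exists_large_walsh_niho (by omega) hK2 φ hφ1 (traceSign_sq hKcard) hφsq s e
    (by rw [hKcard, ← huv]; exact hg2)
  rw [← huv] at hω
  have hue : u = 2 ^ e + (u - 2 ^ e) := by
    have : 2 ^ e ≤ u := by rw [huv, pow_succ]; omega
    omega
  have hwalsh : walsh (2 * (2 * t)) (fun x => atr (2 * (2 * t))
      (1 * (x ^ 2 ^ e * (x + x ^ 2 ^ (2*t)) ^ (u - 2 ^ e)))) ω =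
      2 ^ (2 * t) * ∑ c, φ (c ^ u + ω * c) := by
    have hterm : ∀ x : GF (2 * (2 * t)), chi (2 * (2 * t)) (atr (2 * (2 * t))
        (1 * (x ^ 2 ^ e * (x + x ^ 2 ^ (2*t)) ^ (u - 2 ^ e))) + atr (2 * (2 * t)) (ω * x)) =
        φ (relTrace hL2 x ^ u + ω * relTrace hL2 x) := by
      intro x
      rw [chi_atr_add hL, ← hφψ]
      congr 1
      ext
      have hT := mem_fixedSubfield.1 (relTrace hL2 x).2
      have hω' := mem_fixedSubfield.1 ω.2
      rw [hue]
      simp only [Nat.add_sub_cancel_left]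
      push_cast
      rw [coe_relTrace, add_pow_char_pow, one_mul, mul_pow, mul_pow, hω', ← coe_relTrace hL2 x,
        pow_right_comm _ (u - 2 ^ e), hT, pow_add, pow_right_comm x, coe_relTrace,
        add_pow_char_pow]
      ring
    have hsum := (relTrace hL2).card_mul_sum_comp hsurj fun c => φ (c ^ u + ω * c)
    rw [hKcard, hL2] at hsum
    push_cast at hsum
    rw [walsh, Finset.sum_congr rfl fun x _ => hterm x]
    apply mul_left_cancel₀ (by positivity : (2 ^ (2 * t) : ℤ) ≠ 0)
    rw [hsum]
    ring
  have hmax : 2 * 2 ^ (3 * t) ≤ maxAbsW (2 * t)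
      (fun x : GF (2*(2*t)) => x ^ 2 ^ e * (x + x ^ 2 ^ (2*t)) ^ (u - 2 ^ e)) := by
    refine le_trans ?_ (Finset.le_sup (b := ((1 : GF (2 * (2 * t))), (ω : GF (2 * (2 * t))))) ?_)
    · simp only [hwalsh]
      zify
      rw [abs_mul, abs_of_pos (by positivity : (0 : ℤ) < 2 ^ (2 * t))]
      calc (2 * 2 ^ (3 * t) : ℤ) = 2 ^ (2 * t) * (2 * 2 ^ t) := by ring
        _ ≤ _ := mul_le_mul_of_nonneg_left hω (by positivity)
    · simp
  have hmaxQ : (2 * 2 ^ (3 * t) : ℚ) ≤ maxAbsW (2 * t)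
      (fun x : GF (2*(2*t)) => x ^ 2 ^ e * (x + x ^ 2 ^ (2*t)) ^ (u - 2 ^ e)) := by
    exact_mod_cast hmax
  rw [nlin, show 2 * (2 * t) - 1 = 4 * t - 1 by omega]
  linarith
end
end

section
/- Let 0 ≤ i ≤ m−1 and define F : F_{2^n} → F_{2^n} by F(x) = x^{2^m+1} + x^{2^i+1}. Then the number of a ∈ F_{2^n}, a ≠ 0, for which the component function F_a is bent equals 2^n − 2^m if and only if i = 0. -/
open scoped Classical BigOperators

noncomputable section

section Trace

variable {n : ℕ}

lemma pow_two_pow_self (hn : n ≠ 0) (x : GF n) : x ^ 2 ^ n = x := by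
  have h := FiniteField.pow_card x
  rwa [← Nat.card_eq_fintype_card, GaloisField.card 2 n hn] at h

lemma card_GF (hn : n ≠ 0) : Fintype.card (GF n) = 2 ^ n := by
  rw [← Nat.card_eq_fintype_card, GaloisField.card 2 n hn]

lemma add_self_GF (x : GF n) : x + x = 0 := CharTwo.add_self_eq_zero x

lemma atr_eq_trace (hn : n ≠ 0) (x : GF n) :
    atr n x = algebraMap (ZMod 2) (GF n) (Algebra.trace (ZMod 2) (GF n) x) := by
  rw [FiniteField.algebraMap_trace_eq_sum_pow, GaloisField.finrank 2 hn, Nat.card_zmod]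
  rfl

lemma atr_add (x y : GF n) : atr n (x + y) = atr n x + atr n y := by
  simp [atr, add_pow_char_pow, Finset.sum_add_distrib]

lemma atr_zero : atr n 0 = 0 := by
  simp [atr]

lemma exists_atr_ne_zero_s14 (hn : n ≠ 0) : ∃ x : GF n, atr n x ≠ 0 := by
  obtain ⟨x, hx⟩ := Algebra.trace_surjective (ZMod 2) (GF n) 1
  exact ⟨x, by simp [atr_eq_trace hn, hx]⟩

lemma atr_eq_zero_or_one (hn : n ≠ 0) (x : GF n) : atr n x = 0 ∨ atr n x = 1 := by
  rw [atr_eq_trace hn]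
  generalize Algebra.trace (ZMod 2) (GF n) x = t
  fin_cases t
  · exact Or.inl (map_zero _)
  · exact Or.inr (map_one _)

lemma atr_sq (hn : n ≠ 0) (x : GF n) : atr n (x ^ 2) = atr n x := by
  have h : atr n (x ^ 2) = atr n x ^ 2 := by
    rw [atr, atr, sum_pow_char 2]
    exact Finset.sum_congr rfl fun j _ => by rw [← pow_mul, ← pow_mul, mul_comm]
  rw [h]
  rcases atr_eq_zero_or_one hn x with h | h <;> simp [h]

lemma atr_pow_two_pow (hn : n ≠ 0) (x : GF n) (j : ℕ) : atr n (x ^ 2 ^ j) = atr n x := by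
  induction j with
  | zero => simp
  | succ j ih => rw [pow_succ, pow_mul, atr_sq hn, ih]

/-- The Frobenius power `x ↦ x ^ 2 ^ j` has adjoint `x ↦ x ^ 2 ^ (n - j)` for the trace form. -/
lemma atr_mul_pow_two_pow (hn : n ≠ 0) {j : ℕ} (hj : j ≤ n) (b x : GF n) :
    atr n (b * x ^ 2 ^ j) = atr n (x * b ^ 2 ^ (n - j)) := by
  rw [← atr_pow_two_pow hn _ (n - j), mul_pow, ← pow_mul, ← pow_add, Nat.add_sub_cancel' hj,
    pow_two_pow_self hn, mul_comm]

lemma chi_add (hn : n ≠ 0) (x y : GF n) :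
    chi n (atr n x + atr n y) = chi n (atr n x) * chi n (atr n y) := by
  rcases atr_eq_zero_or_one hn x with hx | hx <;> rcases atr_eq_zero_or_one hn y with hy | hy <;>
    simp [chi, hx, hy, add_self_GF]

/-- The canonical additive character `x ↦ (-1) ^ Tr x`. -/
def traceChar (hn : n ≠ 0) : AddChar (GF n) ℤ where
  toFun x := chi n (atr n x)
  map_zero_eq_one' := by simp [atr_zero, chi]
  map_add_eq_mul' x y := by rw [atr_add, chi_add hn]

lemma traceChar_apply (hn : n ≠ 0) (x : GF n) : traceChar hn x = chi n (atr n x) := rfl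

lemma traceChar_mul_self (hn : n ≠ 0) (x : GF n) : traceChar hn x * traceChar hn x = 1 := by
  rw [traceChar_apply, chi]
  split_ifs <;> simp

lemma sum_traceChar_mul (hn : n ≠ 0) (y : GF n) :
    ∑ x, traceChar hn (x * y) = if y = 0 then 2 ^ n else 0 := by
  have h := AddChar.sum_eq_ite ((traceChar hn).compAddMonoidHom (AddMonoidHom.mulRight y))
  simp only [AddChar.compAddMonoidHom_apply, AddMonoidHom.coe_mulRight] at h
  rw [h, card_GF hn]
  split_ifs with h1 h2 h2
  · simp
  · exfalso
    obtain ⟨z, hz⟩ := exists_atr_ne_zero_s14 hn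
    have h3 := DFunLike.congr_fun h1 (z / y)
    simp [traceChar_apply, chi, div_mul_cancel₀ _ h2, hz] at h3
  · exfalso
    apply h1
    ext x
    simp [h2]
  · rfl

lemma card_dvd_sum_traceChar (hn : n ≠ 0) (A : AddSubgroup (GF n)) (y : GF n) :
    (Fintype.card A : ℤ) ∣ ∑ a : A, traceChar hn (a * y) := by
  have h := AddChar.sum_eq_ite
    ((traceChar hn).compAddMonoidHom ((AddMonoidHom.mulRight y).comp A.subtype))
  simp only [AddChar.compAddMonoidHom_apply, AddMonoidHom.coe_comp, AddMonoidHom.coe_mulRight,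
    Function.comp_apply, AddSubgroup.coe_subtype] at h
  rw [h]
  split_ifs <;> simp

/-- Every Walsh coefficient of the component `Tr (a F)` has absolute value `2 ^ (n / 2)`. -/
def IsBentComponent (n : ℕ) (F : GF n → GF n) (a : GF n) : Prop :=
  ∀ ω : GF n, walsh n (fun x => atr n (a * F x)) ω ^ 2 = 2 ^ n

lemma walsh_eq_sum_traceChar (hn : n ≠ 0) (F : GF n → GF n) (a ω : GF n) :
    walsh n (fun x => atr n (a * F x)) ω = ∑ x, traceChar hn (a * F x + ω * x) := by
  simp only [walsh, traceChar_apply, atr_add]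

lemma walsh_zero (hn : n ≠ 0) (F : GF n → GF n) :
    walsh n (fun x => atr n (0 * F x)) 0 = 2 ^ n := by
  rw [walsh_eq_sum_traceChar hn]
  simp [card_GF hn]

/-- The Walsh transform of a quadratic component with associated linear map `L`. -/
lemma walsh_sq_eq (hn : n ≠ 0) (F L : GF n → GF n) (a ω : GF n)
    (hL : ∀ x u, traceChar hn (a * F (x + u)) =
      traceChar hn (a * F x) * traceChar hn (a * F u) * traceChar hn (x * L u)) :
    walsh n (fun x => atr n (a * F x)) ω ^ 2 =
      2 ^ n * ∑ u with L u = 0, traceChar hn (a * F u + ω * u) := by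
  set g : GF n → ℤ := fun x => traceChar hn (a * F x + ω * x) with hg
  have hgadd : ∀ x u, g x * g (x + u) = g u * traceChar hn (x * L u) := by
    intro x u
    have h1 := traceChar_mul_self hn (a * F x)
    have h2 := traceChar_mul_self hn (ω * x)
    simp only [hg, AddChar.map_add_eq_mul, mul_add, hL]
    linear_combination (traceChar hn (a * F u) * traceChar hn (x * L u) * traceChar hn (ω * u)) *
      ((traceChar hn (ω * x) * traceChar hn (ω * x)) * h1 + h2)
  rw [walsh_eq_sum_traceChar hn, sq, Finset.sum_mul_sum]
  calc ∑ x, ∑ y, g x * g y = ∑ x, ∑ u, g x * g (x + u) :=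
        Finset.sum_congr rfl fun x _ =>
          (Fintype.sum_equiv (Equiv.addLeft x) _ _ fun u => rfl).symm
    _ = ∑ u, g u * ∑ x, traceChar hn (x * L u) := by
        rw [Finset.sum_comm]
        simp only [hgadd, Finset.mul_sum]
    _ = _ := by
        simp only [sum_traceChar_mul, Finset.mul_sum, Finset.sum_filter]
        exact Finset.sum_congr rfl fun u _ => by split_ifs <;> ring

/-- A quadratic component is bent iff its associated linear map has trivial kernel. -/
lemma isBentComponent_iff (hn : n ≠ 0) (F : GF n → GF n) (L : GF n →+ GF n) (a : GF n)
    (hL : ∀ x u, traceChar hn (a * F (x + u)) =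
      traceChar hn (a * F x) * traceChar hn (a * F u) * traceChar hn (x * L u)) :
    IsBentComponent n F a ↔ ∀ u, L u = 0 → u = 0 := by
  have hF0 : traceChar hn (a * F 0) = 1 := by
    have h := hL 0 0
    have h2 := traceChar_mul_self hn (a * F 0)
    simp only [add_zero, zero_mul, AddChar.map_zero_eq_one, mul_one, h2] at h
    exact h
  constructor
  · intro hb
    have h := hb 0
    rw [walsh_sq_eq hn F L a 0 hL] at h
    simp only [zero_mul, add_zero] at h
    have hsum : ∑ u with L u = 0, traceChar hn (a * F u) = 1 := by
      have : (2 : ℤ) ^ n ≠ 0 := by positivity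
      exact mul_left_cancel₀ this (by rw [h, mul_one])
    have hone : ∀ v, L v = 0 → traceChar hn (a * F v) = 1 := by
      intro v hv
      have hshift : ∑ u with L u = 0, traceChar hn (a * F (u + v)) =
          ∑ u with L u = 0, traceChar hn (a * F u) := by
        simp only [Finset.sum_filter]
        exact Fintype.sum_equiv (Equiv.addRight v) _ _ fun u => by simp [hv]
      simp only [hL, hv, mul_zero, AddChar.map_zero_eq_one, mul_one, ← Finset.sum_mul, hsum,
        one_mul] at hshift
      exact hshift
    rw [Finset.sum_congr rfl fun u hu => hone u (Finset.mem_filter.1 hu).2] at hsum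
    intro u hu
    have hcard : (Finset.univ.filter fun u => L u = 0).card ≤ 1 := by
      simp only [Finset.sum_const, nsmul_eq_mul, mul_one] at hsum
      exact_mod_cast hsum.le
    exact Finset.card_le_one.1 hcard u (by simp [hu]) 0 (by simp)
  · intro hker ω
    have hfil : (Finset.univ.filter fun u => L u = 0) = {0} := by
      ext u
      simp only [Finset.mem_filter, Finset.mem_univ, true_and, Finset.mem_singleton]
      exact ⟨hker u, fun h => by simp [h]⟩
    rw [walsh_sq_eq hn F L a ω hL, hfil]
    simp [hF0]

end Trace

section BentSubspaces

lemma mem_zmultiples_of_add_self {G : Type*} [AddGroup G] (h2 : ∀ x : G, x + x = 0) {c x : G}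
    (hx : x ∈ AddSubgroup.zmultiples c) : x = 0 ∨ x = c := by
  obtain ⟨k, rfl⟩ := AddSubgroup.mem_zmultiples_iff.1 hx
  obtain ⟨j, rfl | rfl⟩ := Int.even_or_odd' k
  · left
    rw [mul_comm, mul_zsmul, two_zsmul, h2, zsmul_zero]
  · right
    rw [add_zsmul, mul_comm, mul_zsmul, two_zsmul, h2, zsmul_zero, one_zsmul, zero_add]

/-- A set of size `2 ^ m` in an elementary abelian group of order `2 ^ (2 * m)` which contains `0`
and meets every subgroup of order at least `2 ^ (m + 1)` nontrivially is a subgroup. -/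
lemma add_mem_of_blocking {G : Type*} [AddCommGroup G] [Finite G] (h2 : ∀ x : G, x + x = 0)
    {m : ℕ} (hG : Nat.card G = 2 ^ (2 * m)) (S : Finset G) (hS : S.card = 2 ^ m) (h0 : 0 ∈ S)
    (hblock : ∀ A : AddSubgroup G, 2 ^ (m + 1) ∣ Nat.card A → ∃ a ∈ A, a ≠ 0 ∧ a ∈ S)
    {a b : G} (ha : a ∈ S) (hb : b ∈ S) : a + b ∈ S := by
  by_contra hab
  have ha0 : a ≠ 0 := by rintro rfl; exact hab (by simpa using hb)
  have hne : a ≠ b := by rintro rfl; exact hab (by simpa [h2] using h0)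
  obtain ⟨A, ⟨hcA, hA⟩, hmax⟩ := (Set.toFinite
    {A : AddSubgroup G | a + b ∈ A ∧ ∀ s ∈ S, s ∈ A → s = 0}).exists_maximal
    ⟨AddSubgroup.zmultiples (a + b), AddSubgroup.mem_zmultiples _, fun s hs hs' =>
      (mem_zmultiples_of_add_self h2 hs').resolve_right fun h => hab (h ▸ hs)⟩
  have hq2 : ∀ x : G ⧸ A, x + x = 0 := by
    intro x
    obtain ⟨y, rfl⟩ := QuotientAddGroup.mk_surjective x
    rw [← QuotientAddGroup.mk_add, h2, QuotientAddGroup.mk_zero]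
  have hcover : ∀ v : G ⧸ A, v ≠ 0 → ∃ s ∈ S, s ≠ 0 ∧ (s : G ⧸ A) = v := by
    intro v hv
    by_contra! hno
    let A' : AddSubgroup G := (AddSubgroup.zmultiples v).comap (QuotientAddGroup.mk' A)
    have hle : A ≤ A' := fun x hx => by
      have : (x : G ⧸ A) = 0 := (QuotientAddGroup.eq_zero_iff x).2 hx
      simp [A', AddSubgroup.mem_comap, this, zero_mem]
    have hA' : ∀ s ∈ S, s ∈ A' → s = 0 := by
      intro s hs hsA
      rcases mem_zmultiples_of_add_self hq2 (AddSubgroup.mem_comap.1 hsA) with h | h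
      · exact hA s hs ((QuotientAddGroup.eq_zero_iff s).1 h)
      · by_contra hs0
        exact hno s hs hs0 h
    have hle' := hmax (show A' ∈ _ from ⟨hle hcA, hA'⟩) hle
    obtain ⟨y, rfl⟩ := QuotientAddGroup.mk_surjective v
    exact hv ((QuotientAddGroup.eq_zero_iff y).2
      (hle' (AddSubgroup.mem_comap.2 (AddSubgroup.mem_zmultiples _))))
  have : Fintype (G ⧸ A) := Fintype.ofFinite _
  have hsub : (Finset.univ : Finset (G ⧸ A)) ⊆
      (S.erase a).image (QuotientAddGroup.mk : G → G ⧸ A) := by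
    intro v _
    rw [Finset.mem_image]
    by_cases hv : v = 0
    · exact ⟨0, Finset.mem_erase.2 ⟨ha0.symm, h0⟩, hv.symm⟩
    · obtain ⟨s, hs, -, rfl⟩ := hcover v hv
      by_cases hsa : s = a
      · refine ⟨b, Finset.mem_erase.2 ⟨hne.symm, hb⟩, ?_⟩
        rw [hsa, eq_comm, QuotientAddGroup.eq, neg_eq_of_add_eq_zero_left (h2 a)]
        exact hcA
      · exact ⟨s, Finset.mem_erase.2 ⟨hsa, hs⟩, rfl⟩
  have hlt : Nat.card (G ⧸ A) < 2 ^ m := by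
    have h1 := (Finset.card_le_card hsub).trans Finset.card_image_le
    rw [Finset.card_erase_of_mem ha, hS, Finset.card_univ, ← Nat.card_eq_fintype_card] at h1
    have : 0 < 2 ^ m := by positivity
    omega
  have hmul := AddSubgroup.card_eq_card_quotient_mul_card_addSubgroup A
  obtain ⟨k, -, hk⟩ := (Nat.dvd_prime_pow Nat.prime_two).1
    (hG ▸ AddSubgroup.card_addSubgroup_dvd_card A)
  have hkm : m + 1 ≤ k := by
    by_contra! hlt'
    have h1 : 2 ^ k ≤ 2 ^ m := Nat.pow_le_pow_right (by norm_num) (by omega)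
    rw [hG, hk, two_mul, pow_add] at hmul
    have : 0 < 2 ^ m := by positivity
    nlinarith
  obtain ⟨s, hsA, hs0, hsS⟩ := hblock A (hk ▸ pow_dvd_pow 2 hkm)
  exact hs0 (hA s hsS hsA)

/-- A subgroup of order at least `2 ^ (m + 1)` contains a nonzero non-bent component. -/
lemma exists_not_isBentComponent {m : ℕ} (hm : 1 ≤ m) (F : GF (2 * m) → GF (2 * m))
    (A : AddSubgroup (GF (2 * m))) (hA : 2 ^ (m + 1) ∣ Nat.card A) :
    ∃ a ∈ A, a ≠ 0 ∧ ¬ IsBentComponent (2 * m) F a := by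
  by_contra! hbent
  have hn : 2 * m ≠ 0 := by omega
  have hw : ∀ a : A, ∃ c : ℤ, walsh (2 * m) (fun x => atr (2 * m) (a * F x)) 0 = 2 ^ m * c ∧
      (c : ZMod 2) = if a = 0 then 0 else 1 := by
    intro a
    by_cases ha : a = 0
    · refine ⟨2 ^ m, ?_, ?_⟩
      · rw [ha, AddSubgroup.coe_zero, walsh_zero hn, two_mul, pow_add]
      · have : (2 : ZMod 2) = 0 := rfl
        simp [ha, this, show m ≠ 0 by omega]
    · have h := hbent a a.2 (by simpa using ha) 0
      have hpow : (2 : ℤ) ^ (2 * m) = (2 ^ m) ^ 2 := by rw [← pow_mul, mul_comm]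
      rw [hpow, sq_eq_sq_iff_eq_or_eq_neg] at h
      rcases h with h | h
      · exact ⟨1, by rw [h, mul_one], by simp [ha]⟩
      · exact ⟨-1, by rw [h, mul_neg_one], by simp [ha]⟩
  choose c hc hc2 using hw
  have hdvd : (2 : ℤ) ^ m * 2 ∣ 2 ^ m * ∑ a, c a := by
    have h1 : ((2 ^ (m + 1) : ℕ) : ℤ) ∣ (Nat.card A : ℤ) := Int.natCast_dvd_natCast.2 hA
    rw [Nat.card_eq_fintype_card] at h1
    rw [Finset.mul_sum, ← Finset.sum_congr rfl fun a _ => hc a]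
    simp only [walsh_eq_sum_traceChar hn, zero_mul, add_zero]
    rw [Finset.sum_comm]
    refine Finset.dvd_sum fun x _ => ?_
    refine dvd_trans ?_ (card_dvd_sum_traceChar hn A (F x))
    simpa [pow_succ] using h1
  have hsum := (ZMod.intCast_zmod_eq_zero_iff_dvd _ 2).2
    (Int.dvd_of_mul_dvd_mul_left (by positivity) hdvd)
  have hcard : (Fintype.card A : ZMod 2) = 0 := by
    rw [ZMod.natCast_eq_zero_iff, ← Nat.card_eq_fintype_card]
    exact dvd_trans (dvd_pow_self 2 (by omega)) hA
  have hsplit : ∀ a : A, (c a : ZMod 2) = 1 - if a = 0 then 1 else 0 := by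
    intro a
    rw [hc2]
    split_ifs <;> simp
  rw [Int.cast_sum, Finset.sum_congr rfl fun a _ => hsplit a, Finset.sum_sub_distrib] at hsum
  simp [hcard] at hsum

end BentSubspaces

section FixedField

variable {n : ℕ}

/-- The fixed points of the Frobenius power `x ↦ x ^ 2 ^ k`. -/
def frobFixed (n k : ℕ) : Finset (GF n) := Finset.univ.filter fun x => x ^ 2 ^ k = x

lemma mem_frobFixed {k : ℕ} {x : GF n} : x ∈ frobFixed n k ↔ x ^ 2 ^ k = x := by
  simp [frobFixed]

lemma pow_two_pow_mul_of_mem {k : ℕ} {x : GF n} (hx : x ∈ frobFixed n k) (j : ℕ) :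
    x ^ 2 ^ (k * j) = x := by
  rw [mem_frobFixed] at hx
  induction j with
  | zero => simp
  | succ j ih => rw [mul_add, mul_one, pow_add, pow_mul, ih, hx]

lemma card_frobFixed_le {k : ℕ} (hk : k ≠ 0) : (frobFixed n k).card ≤ 2 ^ k := by
  have hlt : 1 < 2 ^ k := Nat.one_lt_two_pow hk
  have hne := FiniteField.X_pow_card_sub_X_ne_zero (GF n) hlt
  calc (frobFixed n k).card
      ≤ (Polynomial.X ^ 2 ^ k - Polynomial.X : Polynomial (GF n)).roots.toFinset.card := by
        refine Finset.card_le_card fun x hx => ?_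
        rw [Multiset.mem_toFinset, Polynomial.mem_roots hne]
        simp [mem_frobFixed.1 hx]
    _ ≤ _ := Multiset.toFinset_card_le _
    _ ≤ _ := Polynomial.card_roots' _
    _ = 2 ^ k := FiniteField.X_pow_card_sub_X_natDegree_eq (GF n) hlt

lemma card_frobFixed_two_mul_le (k : ℕ) :
    (frobFixed n (2 * k)).card ≤ (frobFixed n k).card * (frobFixed n k).card := by
  have hsq : ∀ x : GF n, (x ^ 2 ^ k) ^ 2 ^ k = x ^ 2 ^ (2 * k) := fun x => by
    rw [← pow_mul, ← pow_add, two_mul]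
  refine Finset.card_le_mul_card_image_of_maps_to (f := fun x => x ^ 2 ^ k + x) ?_ _ ?_
  · intro x hx
    rw [mem_frobFixed] at hx ⊢
    rw [add_pow_char_pow, hsq, hx, add_comm]
  · intro b _
    rcases Finset.eq_empty_or_nonempty
      ((frobFixed n (2 * k)).filter fun x => x ^ 2 ^ k + x = b) with he | ⟨y, hy⟩
    · simp [he]
    · refine Finset.card_le_card_of_injOn (fun x => x + y) ?_ fun _ _ _ _ h => add_right_cancel h
      intro x hx
      have hx := (Finset.mem_filter.1 (Finset.mem_coe.1 hx)).2
      have hy := (Finset.mem_filter.1 hy).2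
      rw [Finset.mem_coe, mem_frobFixed, add_pow_char_pow]
      have h := hx.trans hy.symm
      linear_combination h + add_self_GF (y ^ 2 ^ k) - add_self_GF x

lemma frobFixed_self (hn : n ≠ 0) : frobFixed n n = Finset.univ := by
  ext x
  simp [mem_frobFixed, pow_two_pow_self hn]

lemma card_frobFixed_of_two_mul {k : ℕ} (hk : k ≠ 0)
    (h : (frobFixed n (2 * k)).card = 2 ^ (2 * k)) : (frobFixed n k).card = 2 ^ k := by
  have h1 := card_frobFixed_two_mul_le (n := n) k
  rw [h, two_mul, pow_add] at h1
  exact le_antisymm (card_frobFixed_le hk) (Nat.mul_self_le_mul_self_iff.1 h1)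

lemma card_frobFixed_half {m : ℕ} (hm : m ≠ 0) : (frobFixed (2 * m) m).card = 2 ^ m := by
  apply card_frobFixed_of_two_mul hm
  rw [frobFixed_self (by omega), Finset.card_univ, card_GF (by omega)]

lemma frobFixed_add {k : ℕ} {x y : GF n} (hx : x ∈ frobFixed n k) (hy : y ∈ frobFixed n k) :
    x + y ∈ frobFixed n k := by
  rw [mem_frobFixed] at *
  rw [add_pow_char_pow, hx, hy]

lemma frobFixed_mul {k : ℕ} {x y : GF n} (hx : x ∈ frobFixed n k) (hy : y ∈ frobFixed n k) :
    x * y ∈ frobFixed n k := by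
  rw [mem_frobFixed] at *
  rw [mul_pow, hx, hy]

lemma frobFixed_inv {k : ℕ} {x : GF n} (hx : x ∈ frobFixed n k) : x⁻¹ ∈ frobFixed n k := by
  rw [mem_frobFixed] at *
  rw [inv_pow, hx]

lemma frobFixed_pow {k : ℕ} {x : GF n} (hx : x ∈ frobFixed n k) (j : ℕ) :
    x ^ j ∈ frobFixed n k := by
  rw [mem_frobFixed] at *
  rw [← pow_mul, mul_comm, pow_mul, hx]

lemma frobFixed_one (k : ℕ) : (1 : GF n) ∈ frobFixed n k := by
  simp [mem_frobFixed]

end FixedField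

section Component

variable {m i : ℕ}

/-- The map `x ↦ x ^ (2 ^ m + 1) + x ^ (2 ^ i + 1)`. -/
def binomialMap (m i : ℕ) (x : GF (2 * m)) : GF (2 * m) := x ^ (2 ^ m + 1) + x ^ (2 ^ i + 1)

/-- The linear map representing the polar form of the component `Tr (a F)`, where `F` is
`binomialMap m i`. -/
def polarMap (m i : ℕ) (a u : GF (2 * m)) : GF (2 * m) :=
  a * u ^ 2 ^ m + (a * u) ^ 2 ^ m + a * u ^ 2 ^ i + (a * u) ^ 2 ^ (2 * m - i)

lemma polarMap_add_right (a u v : GF (2 * m)) :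
    polarMap m i a (u + v) = polarMap m i a u + polarMap m i a v := by
  simp only [polarMap, mul_add, add_pow_char_pow]
  ring

lemma polarMap_add_left (a b u : GF (2 * m)) :
    polarMap m i (a + b) u = polarMap m i a u + polarMap m i b u := by
  simp only [polarMap, add_mul, add_pow_char_pow]
  ring

lemma polarMap_zero_left (u : GF (2 * m)) : polarMap m i 0 u = 0 := by
  simp [polarMap]

lemma atr_mul_polarMap (hm : 2 * m ≠ 0) (hi : i ≤ 2 * m) (a x u : GF (2 * m)) :
    atr (2 * m) (x * polarMap m i a u) =
      atr (2 * m) (a * (x ^ 2 ^ m * u + x * u ^ 2 ^ m + (x ^ 2 ^ i * u + x * u ^ 2 ^ i))) := by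
  have h1 := atr_mul_pow_two_pow hm (show m ≤ 2 * m by omega) (a * u) x
  have h2 := atr_mul_pow_two_pow hm hi (a * u) x
  rw [show 2 * m - m = m by omega] at h1
  simp only [polarMap, mul_add, atr_add, ← h1, ← h2]
  ring_nf

lemma binomialMap_add (x u : GF (2 * m)) :
    binomialMap m i (x + u) = binomialMap m i x + binomialMap m i u +
      (x ^ 2 ^ m * u + x * u ^ 2 ^ m + (x ^ 2 ^ i * u + x * u ^ 2 ^ i)) := by
  simp only [binomialMap, pow_succ, add_pow_char_pow]
  ring

lemma isBentComponent_binomialMap_iff (hm : 2 * m ≠ 0) (hi : i ≤ 2 * m) (a : GF (2 * m)) :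
    IsBentComponent (2 * m) (binomialMap m i) a ↔ ∀ u, polarMap m i a u = 0 → u = 0 := by
  refine isBentComponent_iff hm _ (AddMonoidHom.mk' (polarMap m i a) (polarMap_add_right a)) a ?_
  intro x u
  rw [binomialMap_add, mul_add, mul_add, AddChar.map_add_eq_mul, AddChar.map_add_eq_mul]
  congr 1
  rw [traceChar_apply, traceChar_apply, AddMonoidHom.mk'_apply, atr_mul_polarMap hm hi]

/-- Every nonzero `u` lies in the kernel of the polar form of some nonzero component. -/
lemma exists_polarMap_eq_zero (hm : 2 * m ≠ 0) (hi : i ≤ 2 * m) {u : GF (2 * m)} (hu : u ≠ 0) :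
    ∃ a, a ≠ 0 ∧ polarMap m i a u = 0 := by
  by_contra! h
  have hinj : Function.Injective
      (AddMonoidHom.mk' (fun a => polarMap m i a u) fun a b => polarMap_add_left a b u) := by
    rw [injective_iff_map_eq_zero]
    intro a ha
    by_contra ha0
    exact h a ha0 ha
  obtain ⟨z, hz⟩ := exists_atr_ne_zero_s14 hm
  obtain ⟨a, ha⟩ := Finite.surjective_of_injective hinj (u⁻¹ * z)
  rw [AddMonoidHom.mk'_apply] at ha
  have h1 := atr_mul_polarMap hm hi a u u
  rw [ha, mul_inv_cancel_left₀ hu, mul_comm u, add_self_GF, mul_comm u, add_self_GF, add_zero,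
    mul_zero, atr_zero] at h1
  exact hz h1

end Component

section NonBent

variable {m i : ℕ}

/-- The `a` for which the component `Tr (a F)` of `F = binomialMap m i` is not bent. -/
def nonBent (m i : ℕ) : Finset (GF (2 * m)) :=
  Finset.univ.filter fun a => ∃ u, u ≠ 0 ∧ polarMap m i a u = 0

lemma mem_nonBent {a : GF (2 * m)} :
    a ∈ nonBent m i ↔ ∃ u, u ≠ 0 ∧ polarMap m i a u = 0 := by
  simp [nonBent]

lemma zero_mem_nonBent : (0 : GF (2 * m)) ∈ nonBent m i :=
  mem_nonBent.2 ⟨1, one_ne_zero, polarMap_zero_left 1⟩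

lemma isBentComponent_iff_notMem (hm : 2 * m ≠ 0) (hi : i ≤ 2 * m) (a : GF (2 * m)) :
    IsBentComponent (2 * m) (binomialMap m i) a ↔ a ∉ nonBent m i := by
  rw [isBentComponent_binomialMap_iff hm hi, mem_nonBent]
  push Not
  exact forall_congr' fun u => not_imp_not.symm

lemma nonBent_add (hm : 1 ≤ m) (hi : i ≤ 2 * m) (hS : (nonBent m i).card = 2 ^ m)
    {a b : GF (2 * m)} (ha : a ∈ nonBent m i) (hb : b ∈ nonBent m i) : a + b ∈ nonBent m i := by
  have hn : 2 * m ≠ 0 := by omega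
  refine add_mem_of_blocking add_self_GF (GaloisField.card 2 _ hn) _ hS zero_mem_nonBent ?_ ha hb
  intro A hA
  obtain ⟨c, hcA, hc0, hc⟩ := exists_not_isBentComponent hm (binomialMap m i) A hA
  rw [isBentComponent_iff_notMem hn hi, not_not] at hc
  exact ⟨c, hcA, hc0, hc⟩

lemma nonBent_zero_right (hm : 1 ≤ m) : nonBent m 0 = frobFixed (2 * m) m := by
  have hpolar : ∀ a u : GF (2 * m), polarMap m 0 a u = (a ^ 2 ^ m + a) * u ^ 2 ^ m := by
    intro a u
    rw [polarMap, Nat.sub_zero, pow_two_pow_self (by omega), pow_zero, pow_one, mul_pow]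
    linear_combination add_self_GF (a * u)
  ext a
  simp only [mem_nonBent, mem_frobFixed, hpolar, mul_eq_zero]
  constructor
  · rintro ⟨u, hu, h | h⟩
    · exact CharTwo.add_eq_zero.1 h
    · exact absurd (pow_eq_zero_iff (by positivity) |>.1 h) hu
  · intro h
    exact ⟨1, one_ne_zero, Or.inl (CharTwo.add_eq_zero.2 h)⟩

/-- For `0 < i < m` the non-bent components are not exactly those in the subfield of order
`2 ^ m`. -/
lemma nonBent_ne_frobFixed (hi0 : 0 < i) (him : i < m) : nonBent m i ≠ frobFixed (2 * m) m := by
  intro hS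
  have hn : 2 * m ≠ 0 := by omega
  have hratio : ∀ x : GF (2 * m), x ≠ 0 → x ^ 2 ^ (2 * i) * x⁻¹ ∈ frobFixed (2 * m) m := by
    intro x hx
    obtain ⟨a, ha0, ha⟩ := exists_polarMap_eq_zero hn (show i ≤ 2 * m by omega) hx
    have haK : a ∈ frobFixed (2 * m) m := hS ▸ mem_nonBent.2 ⟨x, hx, ha⟩
    have h1 : a * x ^ 2 ^ i = (a * x) ^ 2 ^ (2 * m - i) := by
      rw [polarMap, mul_pow a x (2 ^ m), mem_frobFixed.1 haK, add_self_GF, zero_add] at ha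
      exact CharTwo.add_eq_zero.1 ha
    have h2 : a ^ 2 ^ i * x ^ 2 ^ (2 * i) = a * x := by
      have h := congrArg (· ^ 2 ^ i) h1
      rw [← pow_mul (a * x), ← pow_add, Nat.sub_add_cancel (by omega), pow_two_pow_self hn,
        mul_pow, ← pow_mul x, ← pow_add, ← two_mul] at h
      exact h
    have h3 : x ^ 2 ^ (2 * i) * x⁻¹ = a * (a ^ 2 ^ i)⁻¹ := by
      field_simp
      linear_combination h2
    rw [h3]
    exact frobFixed_mul haK (frobFixed_inv (frobFixed_pow haK _))
  have hcover : (Finset.univ : Finset (GF (2 * m))) ⊆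
      frobFixed (2 * m) m ∪ frobFixed (2 * m) (2 * i) := by
    intro x _
    rw [Finset.mem_union]
    by_cases hx0 : x = 0
    · exact Or.inl (by simp [hx0, mem_frobFixed])
    by_cases hx1 : x = 1
    · exact Or.inl (hx1 ▸ frobFixed_one m)
    have hx1' : x + 1 ≠ 0 := fun h => hx1 (CharTwo.add_eq_zero.1 h)
    have hr := hratio x hx0
    have hr' := hratio (x + 1) hx1'
    obtain ⟨r, hrdef⟩ : ∃ r, r = x ^ 2 ^ (2 * i) * x⁻¹ := ⟨_, rfl⟩
    obtain ⟨s, hsdef⟩ : ∃ s, s = (x + 1) ^ 2 ^ (2 * i) * (x + 1)⁻¹ := ⟨_, rfl⟩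
    rw [← hrdef] at hr
    rw [← hsdef] at hr'
    have e1 : x ^ 2 ^ (2 * i) = r * x := by rw [hrdef, inv_mul_cancel_right₀ hx0]
    have e2 : x ^ 2 ^ (2 * i) + 1 = s * (x + 1) := by
      rw [hsdef, inv_mul_cancel_right₀ hx1', add_pow_char_pow, one_pow]
    have e3 : x * (r + s) = s + 1 := by
      linear_combination e2 - e1 + add_self_GF (s * x) - add_self_GF (1 : GF (2 * m))
    by_cases hrs : r + s = 0
    · right
      have hs : s = 1 := by
        rw [hrs, mul_zero] at e3
        exact CharTwo.add_eq_zero.1 e3.symm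
      have hr1 : r = 1 := (CharTwo.add_eq_zero.1 hrs).trans hs
      rw [mem_frobFixed, e1, hr1, one_mul]
    · left
      rw [(eq_mul_inv_iff_mul_eq₀ hrs).2 e3]
      exact frobFixed_mul (frobFixed_add hr' (frobFixed_one m))
        (frobFixed_inv (frobFixed_add hr hr'))
  have h1 := (Finset.card_le_card hcover).trans (Finset.card_union_le _ _)
  rw [Finset.card_univ, card_GF hn, card_frobFixed_half (by omega)] at h1
  have h2 := card_frobFixed_le (n := 2 * m) (show 2 * i ≠ 0 by omega)
  have h3 : 2 ^ (2 * i) < 2 ^ (2 * m - 1) := Nat.pow_lt_pow_right (by norm_num) (by omega)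
  have h4 : 2 ^ m ≤ 2 ^ (2 * m - 1) := Nat.pow_le_pow_right (by norm_num) (by omega)
  have h5 : 2 ^ (2 * m) = 2 ^ (2 * m - 1) * 2 := by rw [← pow_succ]; congr 1; omega
  omega

lemma exists_mem_frobFixed_pow_ne (hi0 : 0 < i) (him : i < m) (hne : m ≠ 2 * i) :
    ∃ y ∈ frobFixed (2 * m) m, y ^ 2 ^ (2 * i) ≠ y := by
  by_contra! h
  have hcontra : ∀ k, k ≠ 0 → k < m → ¬ frobFixed (2 * m) m ⊆ frobFixed (2 * m) k := by
    intro k hk hkm hsub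
    have h1 := (Finset.card_le_card hsub).trans (card_frobFixed_le hk)
    rw [card_frobFixed_half (by omega)] at h1
    exact absurd h1 (not_le.2 (Nat.pow_lt_pow_right (by norm_num) hkm))
  rcases lt_or_gt_of_ne hne with hlt | hgt
  · refine hcontra (2 * i - m) (by omega) (by omega) fun y hy => ?_
    have hy2 := h y hy
    rw [show 2 * i = m + (2 * i - m) by omega, pow_add, pow_mul, mem_frobFixed.1 hy] at hy2
    exact mem_frobFixed.2 hy2
  · exact hcontra (2 * i) (by omega) hgt fun y hy => mem_frobFixed.2 (h y hy)

lemma pow_mem_nonBent (him : i < m) {x : GF (2 * m)} (hx : x ∈ frobFixed (2 * m) m) :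
    x ^ (2 ^ i + 1) ∈ nonBent m i := by
  by_cases hx0 : x = 0
  · rw [hx0, zero_pow (by positivity)]
    exact zero_mem_nonBent
  refine mem_nonBent.2 ⟨x⁻¹, inv_ne_zero hx0, ?_⟩
  have h1 : x ^ (2 ^ i + 1) * x⁻¹ = x ^ 2 ^ i := by
    rw [pow_succ, mul_inv_cancel_right₀ hx0]
  have h2 : x ^ (2 ^ i + 1) * x⁻¹ ^ 2 ^ i = x := by
    rw [pow_succ, inv_pow]
    field_simp
  rw [polarMap, mem_frobFixed.1 (frobFixed_inv hx), h1, h2, mem_frobFixed.1 (frobFixed_pow hx _),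
    add_self_GF, zero_add, ← pow_mul, ← pow_add, Nat.add_sub_cancel' (by omega),
    pow_two_pow_self (by omega), add_self_GF]

/-- If the non-bent components form a group and `m ≠ 2 * i`, they include the subfield of order
`2 ^ m`. -/
lemma frobFixed_subset_nonBent (hi0 : 0 < i) (him : i < m) (hne : m ≠ 2 * i)
    (hadd : ∀ a ∈ nonBent m i, ∀ b ∈ nonBent m i, a + b ∈ nonBent m i) :
    frobFixed (2 * m) m ⊆ nonBent m i := by
  have hpolar : ∀ u ∈ frobFixed (2 * m) m, ∀ z ∈ frobFixed (2 * m) m,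
      u * z ^ 2 ^ i + u ^ 2 ^ i * z ∈ nonBent m i := by
    intro u hu z hz
    have h := hadd _ (hadd _ (pow_mem_nonBent him (frobFixed_add hu hz))
      _ (pow_mem_nonBent him hu)) _ (pow_mem_nonBent him hz)
    convert h using 1
    rw [pow_succ, pow_succ, pow_succ, add_pow_char_pow]
    linear_combination -add_self_GF (u ^ 2 ^ i * u) - add_self_GF (z ^ 2 ^ i * z)
  obtain ⟨y, hy, hyne⟩ := exists_mem_frobFixed_pow_ne hi0 him hne
  have hy0 : y ≠ 0 := by
    rintro rfl
    exact hyne (zero_pow (by positivity))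
  intro w hw
  obtain ⟨κ, hκ⟩ : ∃ κ, κ = 1 + y * (y ^ 2 ^ (2 * i))⁻¹ := ⟨_, rfl⟩
  have hκ0 : κ ≠ 0 := by
    intro h
    have h1 := CharTwo.add_eq_zero.1 (hκ.symm.trans h)
    rw [eq_mul_inv_iff_mul_eq₀ (pow_ne_zero _ hy0), one_mul] at h1
    exact hyne h1
  have hκm : κ ∈ frobFixed (2 * m) m :=
    hκ ▸ frobFixed_add (frobFixed_one m) (frobFixed_mul hy (frobFixed_inv (frobFixed_pow hy _)))
  obtain ⟨u, hu⟩ : ∃ u, u = (w * κ⁻¹) ^ 2 ^ (m - i) := ⟨_, rfl⟩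
  have hwκ := frobFixed_mul hw (frobFixed_inv hκm)
  have hum : u ∈ frobFixed (2 * m) m := hu ▸ frobFixed_pow hwκ _
  have hup : u ^ 2 ^ i = w * κ⁻¹ := by
    rw [hu, ← pow_mul, ← pow_add, Nat.sub_add_cancel him.le, mem_frobFixed.1 hwκ]
  have hz := hpolar _ (frobFixed_mul hum (frobFixed_inv (frobFixed_pow hy (2 ^ i)))) y hy
  convert hadd _ (hpolar u hum 1 (frobFixed_one m)) _ hz using 1
  have e1 : u * (y ^ 2 ^ i)⁻¹ * y ^ 2 ^ i = u := inv_mul_cancel_right₀ (pow_ne_zero _ hy0) u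
  have e2 : (u * (y ^ 2 ^ i)⁻¹) ^ 2 ^ i = w * κ⁻¹ * (y ^ 2 ^ (2 * i))⁻¹ := by
    rw [mul_pow, hup, inv_pow, ← pow_mul, ← pow_add, ← two_mul]
  have e3 : w * κ⁻¹ * (1 + y * (y ^ 2 ^ (2 * i))⁻¹) = w := by
    rw [← hκ, inv_mul_cancel_right₀ hκ0]
  rw [e1, e2, hup, one_pow]
  linear_combination -e3 - add_self_GF u

end NonBent

section DoubleExponent

variable {i : ℕ}

lemma mul_mem_nonBent {c a : GF (2 * (2 * i))} (hc : c ∈ frobFixed (2 * (2 * i)) i)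
    (ha : a ∈ nonBent (2 * i) i) : c * a ∈ nonBent (2 * i) i := by
  obtain ⟨u, hu, h⟩ := mem_nonBent.1 ha
  refine mem_nonBent.2 ⟨u, hu, ?_⟩
  have h2 : c ^ 2 ^ (2 * i) = c := by
    simpa only [mul_comm i 2] using pow_two_pow_mul_of_mem hc 2
  have h3 : c ^ 2 ^ (2 * (2 * i) - i) = c := by
    rw [show 2 * (2 * i) - i = i * 3 by omega, pow_two_pow_mul_of_mem hc]
  have hmul : polarMap (2 * i) i (c * a) u = c * polarMap (2 * i) i a u := by
    simp only [polarMap, mul_pow, h2, h3]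
    ring
  rw [hmul, h, mul_zero]

lemma pow_two_pow_mem_nonBent {m i : ℕ} {a : GF (2 * m)} (ha : a ∈ nonBent m i) (j : ℕ) :
    a ^ 2 ^ j ∈ nonBent m i := by
  obtain ⟨u, hu, h⟩ := mem_nonBent.1 ha
  refine mem_nonBent.2 ⟨u ^ 2 ^ j, pow_ne_zero _ hu, ?_⟩
  have hpow : polarMap m i (a ^ 2 ^ j) (u ^ 2 ^ j) = polarMap m i a u ^ 2 ^ j := by
    simp only [polarMap, add_pow_char_pow, mul_pow, ← pow_mul]
    ring_nf
  rw [hpow, h, zero_pow (by positivity)]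

/-- For `m = 2 * i`, if the non-bent components form a group of order `2 ^ m`, they lie in the
subfield of order `2 ^ m`. -/
lemma nonBent_subset_frobFixed (hi0 : 0 < i)
    (hcard : (nonBent (2 * i) i).card = 2 ^ (2 * i))
    (hadd : ∀ a ∈ nonBent (2 * i) i, ∀ b ∈ nonBent (2 * i) i, a + b ∈ nonBent (2 * i) i) :
    nonBent (2 * i) i ⊆ frobFixed (2 * (2 * i)) (2 * i) := by
  have hp : (frobFixed (2 * (2 * i)) i).card = 2 ^ i :=
    card_frobFixed_of_two_mul (by omega) (card_frobFixed_half (by omega))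
  obtain ⟨N, hN⟩ : ∃ N : GF (2 * (2 * i)) → GF (2 * (2 * i)), ∀ s, N s = s ^ 2 ^ i + s :=
    ⟨_, fun _ => rfl⟩
  have hNadd : ∀ s t, N (s + t) = N s + N t := fun s t => by
    simp only [hN, add_pow_char_pow]
    ring
  have hNmul : ∀ c ∈ frobFixed (2 * (2 * i)) i, ∀ s, N (c * s) = c * N s := fun c hc s => by
    simp only [hN, mul_pow, mem_frobFixed.1 hc]
    ring
  have hN0 : N 0 = 0 := by simp [hN]
  have hNmem : ∀ s ∈ nonBent (2 * i) i, N s ∈ nonBent (2 * i) i := fun s hs => by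
    rw [hN]
    exact hadd _ (pow_two_pow_mem_nonBent hs i) _ hs
  have hN2 : ∀ s, N (N s) = s ^ 2 ^ (2 * i) + s := fun s => by
    have h : (s ^ 2 ^ i) ^ 2 ^ i = s ^ 2 ^ (2 * i) := by
      rw [← pow_mul, ← pow_add, ← two_mul]
    rw [hN (N s), hN, add_pow_char_pow, h]
    linear_combination add_self_GF (s ^ 2 ^ i)
  have hN4 : ∀ s, N (N (N (N s))) = 0 := fun s => by
    have h : (s ^ 2 ^ (2 * i)) ^ 2 ^ (2 * i) = s := by
      rw [← pow_mul, ← pow_add, ← two_mul, pow_two_pow_self (by omega)]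
    rw [hN2 (N (N s)), hN2, add_pow_char_pow, h]
    linear_combination add_self_GF s + add_self_GF (s ^ 2 ^ (2 * i))
  have key : ∀ t ∈ nonBent (2 * i) i, N (N (N t)) = 0 → N (N t) = 0 := by
    intro t ht h3
    by_contra h2
    have hindep : ∀ α ∈ frobFixed (2 * (2 * i)) i, ∀ β ∈ frobFixed (2 * (2 * i)) i,
        ∀ γ, α * t + β * N t + γ * N (N t) = 0 → γ ∈ frobFixed (2 * (2 * i)) i →
        α = 0 ∧ β = 0 ∧ γ = 0 := by
      intro α hα β hβ γ h hγ
      have hα0 : α = 0 := by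
        have h' := congrArg (fun s => N (N s)) h
        simp only [hNadd, hNmul α hα, hNmul β hβ, hNmul γ hγ, h3, hN0, mul_zero, add_zero] at h'
        exact (mul_eq_zero.1 h').resolve_right h2
      rw [hα0, zero_mul, zero_add] at h
      have hβ0 : β = 0 := by
        have h' := congrArg N h
        simp only [hNadd, hNmul β hβ, hNmul γ hγ, h3, hN0, mul_zero, add_zero] at h'
        exact (mul_eq_zero.1 h').resolve_right h2
      rw [hβ0, zero_mul, zero_add] at h
      exact ⟨hα0, hβ0, (mul_eq_zero.1 h).resolve_right h2⟩
    have hle := Finset.card_le_card_of_injOn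
      (s := frobFixed (2 * (2 * i)) i ×ˢ frobFixed (2 * (2 * i)) i ×ˢ frobFixed (2 * (2 * i)) i)
      (t := nonBent (2 * i) i) (fun c => c.1 * t + c.2.1 * N t + c.2.2 * N (N t)) ?_ ?_
    · rw [Finset.card_product, Finset.card_product, hp, hcard, ← pow_add, ← pow_add] at hle
      have := (Nat.pow_le_pow_iff_right (by norm_num)).1 hle
      omega
    · rintro ⟨α, β, γ⟩ hc
      simp only [Finset.coe_product, Set.mem_prod, Finset.mem_coe] at hc
      exact hadd _ (hadd _ (mul_mem_nonBent hc.1 ht) _ (mul_mem_nonBent hc.2.1 (hNmem _ ht)))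
        _ (mul_mem_nonBent hc.2.2 (hNmem _ (hNmem _ ht)))
    · rintro ⟨α, β, γ⟩ hc ⟨α', β', γ'⟩ hc' heq
      simp only [Finset.coe_product, Set.mem_prod, Finset.mem_coe] at hc hc' heq
      obtain ⟨h1, h2, h3⟩ := hindep (α + α') (frobFixed_add hc.1 hc'.1)
        (β + β') (frobFixed_add hc.2.1 hc'.2.1) (γ + γ')
        (by linear_combination heq + add_self_GF (α' * t + β' * N t + γ' * N (N t)))
        (frobFixed_add hc.2.2 hc'.2.2)
      rw [CharTwo.add_eq_zero.1 h1, CharTwo.add_eq_zero.1 h2, CharTwo.add_eq_zero.1 h3]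
  intro s hs
  rw [mem_frobFixed, ← CharTwo.add_eq_zero, ← hN2]
  exact key s hs (key (N s) (hNmem s hs) (hN4 s))

end DoubleExponent

/-- For `0 < i < m` the number of non-bent components (including `a = 0`) is not `2 ^ m`. -/
lemma card_nonBent_ne {m i : ℕ} (hi0 : 0 < i) (him : i < m) : (nonBent m i).card ≠ 2 ^ m := by
  intro hS
  have hadd : ∀ a ∈ nonBent m i, ∀ b ∈ nonBent m i, a + b ∈ nonBent m i :=
    fun a ha b hb => nonBent_add (by omega) (by omega) hS ha hb
  have hK : (frobFixed (2 * m) m).card = 2 ^ m := card_frobFixed_half (by omega)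
  apply nonBent_ne_frobFixed hi0 him
  by_cases hne : m = 2 * i
  · subst hne
    exact Finset.eq_of_subset_of_card_le (nonBent_subset_frobFixed hi0 hS hadd) (by rw [hK, hS])
  · exact (Finset.eq_of_subset_of_card_le (frobFixed_subset_nonBent hi0 him hne hadd)
      (by rw [hK, hS])).symm

/-- `F(x) = x^(2^m+1) + x^(2^i+1)` on `F_{2^(2m)}`, `0 ≤ i ≤ m−1`, has
exactly `2^n − 2^m` bent components if and only if `i = 0`. -/
theorem stmt14 (m : ℕ) (hm : 1 ≤ m) (i : ℕ) (hi : i ≤ m - 1) :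
    (Finset.univ.filter (fun a : GF (2*m) => a ≠ 0 ∧
        ∀ ω : GF (2*m),
          (walsh (2*m)
            (fun x => atr (2*m) (a * (x ^ (2 ^ m + 1) + x ^ (2 ^ i + 1)))) ω) ^ 2
            = 2 ^ (2*m))).card
      = 2 ^ (2*m) - 2 ^ m
    ↔ i = 0 := by
  have hn : 2 * m ≠ 0 := by omega
  have hfilter : (Finset.univ.filter (fun a : GF (2*m) => a ≠ 0 ∧
        ∀ ω : GF (2*m),
          (walsh (2*m)
            (fun x => atr (2*m) (a * (x ^ (2 ^ m + 1) + x ^ (2 ^ i + 1)))) ω) ^ 2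
            = 2 ^ (2*m))) = (nonBent m i)ᶜ := by
    ext a
    have h := isBentComponent_iff_notMem hn (show i ≤ 2 * m by omega) a
    simp only [IsBentComponent, binomialMap] at h
    simp only [Finset.mem_filter, Finset.mem_univ, true_and, Finset.mem_compl, h,
      and_iff_right_iff_imp]
    rintro ha rfl
    exact ha zero_mem_nonBent
  rw [hfilter, Finset.card_compl, card_GF hn]
  constructor
  · intro h
    by_contra hi0
    have h1 : (nonBent m i).card ≤ 2 ^ (2 * m) := card_GF hn ▸ Finset.card_le_univ _
    have h2 : 2 ^ m ≤ 2 ^ (2 * m) := Nat.pow_le_pow_right (by norm_num) (by omega)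
    exact card_nonBent_ne (Nat.pos_of_ne_zero hi0) (show i < m by omega) (by omega)
  · rintro rfl
    rw [nonBent_zero_right hm, card_frobFixed_half (by omega)]
end
end
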